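/- Let (Q,R) be a quadratic monomial presentation and write H_m for the degree-m homology of the complex k(B⊙Γ). (1) The following are equivalent: (i) the set B is finite (equivalently, the algebra kQ/⟨R⟩ is finite-dimensional); (ii) H_0 is finite-dimensional; (iii) H_1 is finite-dimensional. (2) For every integer m ≥ 2, H_m is finite-dimensional. -/

import Mathlib

/-!
Common framework: quivers, paths (as a start vertex together with a list of
composable arrows, listed in order of traversal, so that the paper's path
`c_m ⋯ c_1` corresponds to the list `[c_1, …, c_m]`), gentle and quadratic
monomial presentations, the cochain complex `k(Γ ∥ B)` and the chain complex
`k(B ⊙ Γ)` of the paper.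
-/

namespace GentleTT

structure Quiv where
  V : Type
  A : Type
  [fintV : Fintype V]
  [fintA : Fintype A]
  [decV : DecidableEq V]
  [decA : DecidableEq A]
  src : A → V
  tgt : A → V

attribute [instance] Quiv.fintV Quiv.fintA Quiv.decV Quiv.decA

/-- A "path datum": a start vertex together with the list of arrows traversed. -/
abbrev PathDat (Q : Quiv) := Q.V × List Q.A

def psrc (Q : Quiv) (p : PathDat Q) : Q.V := p.1

def ptgt (Q : Quiv) (p : PathDat Q) : Q.V := p.2.getLast?.elim p.1 Q.tgt

def plen (Q : Quiv) (p : PathDat Q) : ℕ := p.2.length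

/-- `p` is a genuine path: consecutive arrows compose, and the recorded start
vertex is the source of the first arrow (if any). -/
def Ok (Q : Quiv) (p : PathDat Q) : Prop :=
  p.2.Chain' (fun a b => Q.tgt a = Q.src b) ∧ ∀ a ∈ p.2.head?, Q.src a = p.1

/-- `p` is a path none of whose length-2 subpaths lies in `R`
(an element of the basis `B` of `kQ/⟨R⟩`). -/
def InB (Q : Quiv) (R : Set (Q.A × Q.A)) (p : PathDat Q) : Prop :=
  Ok Q p ∧ p.2.Chain' (fun a b => (a, b) ∉ R)

/-- `p` is a path all of whose length-2 subpaths lie in `R` (an element of `Γ`). -/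
def InG (Q : Quiv) (R : Set (Q.A × Q.A)) (p : PathDat Q) : Prop :=
  Ok Q p ∧ p.2.Chain' (fun a b => (a, b) ∈ R)

/-- Parallel paths: same source and same target. -/
def Par (Q : Quiv) (p q : PathDat Q) : Prop :=
  psrc Q p = psrc Q q ∧ ptgt Q p = ptgt Q q

/-- Antiparallel paths: `s(p) = t(q)` and `t(p) = s(q)`. -/
def AntiPar (Q : Quiv) (p q : PathDat Q) : Prop :=
  psrc Q p = ptgt Q q ∧ ptgt Q p = psrc Q q

/-- A cycle: a path of positive length whose source equals its target. -/
def IsCycle (Q : Quiv) (p : PathDat Q) : Prop :=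
  Ok Q p ∧ p.2 ≠ [] ∧ psrc Q p = ptgt Q p

/-- Rotation of a cycle: the paper's `rot (c_m ⋯ c_1) = c_{m-1} ⋯ c_1 c_m`
(the last arrow traversed becomes the first one traversed). -/
def rotP (Q : Quiv) (p : PathDat Q) : PathDat Q :=
  match p.2.getLast? with
  | none => p
  | some a => (Q.src a, a :: p.2.dropLast)

/-- Iterated rotation `rot^i`. -/
def rotI (Q : Quiv) (i : ℕ) (p : PathDat Q) : PathDat Q := (rotP Q)^[i] p

def powL {α : Type} (l : List α) : ℕ → List α
  | 0 => []
  | n + 1 => l ++ powL l n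

/-- The `n`-th power `p^n` of a (cyclic) path. -/
def powP (Q : Quiv) (p : PathDat Q) (n : ℕ) : PathDat Q := (p.1, powL p.2 n)

/-- A primitive cycle: a cycle that is not a proper power of another cycle. -/
def IsPrimitive (Q : Quiv) (p : PathDat Q) : Prop :=
  IsCycle Q p ∧ ∀ (q : PathDat Q) (n : ℕ), IsCycle Q q → 2 ≤ n → p ≠ powP Q q n

/-- The period of a cycle: the least `i ≥ 1` with `rot^i p = p`. -/
noncomputable def periodP (Q : Quiv) (p : PathDat Q) : ℕ :=
  sInf {i : ℕ | 1 ≤ i ∧ rotI Q i p = p}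

/-- Two cycles are conjugate (belong to the same circuit) if one is obtained
from the other by iterated rotation. -/
def RotEquiv (Q : Quiv) (p q : PathDat Q) : Prop := ∃ i : ℕ, rotI Q i p = q

/-- A cocomplete cycle: `p² ∈ B`. -/
def Cocomplete (Q : Quiv) (R : Set (Q.A × Q.A)) (p : PathDat Q) : Prop :=
  IsCycle Q p ∧ InB Q R (powP Q p 2)

/-- A complete cycle: `p² ∈ Γ`. -/
def Complete (Q : Quiv) (R : Set (Q.A × Q.A)) (p : PathDat Q) : Prop :=
  IsCycle Q p ∧ InG Q R (powP Q p 2)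

/-- `B`-maximal path: in `B` and not a proper subpath of another element of `B`. -/
def BMax (Q : Quiv) (R : Set (Q.A × Q.A)) (p : PathDat Q) : Prop :=
  InB Q R p ∧ ∀ q : PathDat Q, InB Q R q → p.2 <:+: q.2 → p.2 = q.2

/-- `Γ`-maximal path: in `Γ` and not a proper subpath of another element of `Γ`. -/
def GMax (Q : Quiv) (R : Set (Q.A × Q.A)) (p : PathDat Q) : Prop :=
  InG Q R p ∧ ∀ q : PathDat Q, InG Q R q → p.2 <:+: q.2 → p.2 = q.2

def Adj (Q : Quiv) (v w : Q.V) : Prop :=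
  ∃ a : Q.A, (Q.src a = v ∧ Q.tgt a = w) ∨ (Q.src a = w ∧ Q.tgt a = v)

/-- Connectedness of the underlying graph of the quiver. -/
def Connected (Q : Quiv) : Prop := ∀ v w : Q.V, Relation.ReflTransGen (Adj Q) v w

/-- A quadratic monomial presentation: the relations are paths of length 2. -/
def IsQuadMon (Q : Quiv) (R : Set (Q.A × Q.A)) : Prop :=
  ∀ r ∈ R, Q.tgt r.1 = Q.src r.2

/-- A gentle presentation. -/
structure IsGentle (Q : Quiv) (R : Set (Q.A × Q.A)) : Prop where
  nonempty : Nonempty Q.V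
  connected : Connected Q
  relComposable : ∀ r ∈ R, Q.tgt r.1 = Q.src r.2
  srcLe : ∀ v : Q.V, {a : Q.A | Q.src a = v}.ncard ≤ 2
  tgtLe : ∀ v : Q.V, {a : Q.A | Q.tgt a = v}.ncard ≤ 2
  uniqNotRelAfter : ∀ a : Q.A, {b : Q.A | Q.tgt a = Q.src b ∧ (a, b) ∉ R}.Subsingleton
  uniqNotRelBefore : ∀ a : Q.A, {c : Q.A | Q.tgt c = Q.src a ∧ (c, a) ∉ R}.Subsingleton
  uniqRelAfter : ∀ a : Q.A, {b : Q.A | Q.tgt a = Q.src b ∧ (a, b) ∈ R}.Subsingleton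
  uniqRelBefore : ∀ a : Q.A, {c : Q.A | Q.tgt c = Q.src a ∧ (c, a) ∈ R}.Subsingleton

/-- A spanning tree of the (finite, connected) quiver `Q`: a set of arrows
which connects all vertices and has exactly `|Q₀| - 1` elements. -/
def IsSpanningTree (Q : Quiv) (T : Set Q.A) : Prop :=
  (∀ v w : Q.V, Relation.ReflTransGen
      (fun x y => ∃ a ∈ T, (Q.src a = x ∧ Q.tgt a = y) ∨ (Q.src a = y ∧ Q.tgt a = x)) v w) ∧
  T.ncard + 1 = Fintype.card Q.V

/-- A set of representatives, one for each rotation class of cycles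
satisfying `Pred`. -/
def IsRepSet (Q : Quiv) (P : Set (PathDat Q)) (Pred : PathDat Q → Prop) : Prop :=
  (∀ p ∈ P, Pred p) ∧ ∀ q : PathDat Q, Pred q → ∃! p, p ∈ P ∧ RotEquiv Q q p

/-- `S` is a valid choice of the paper's set `Crep` for the predicate `Pred`
(e.g. cocompleteness, or completeness): it consists of all positive powers of a
chosen set of representatives of the rotation classes of primitive cycles
satisfying `Pred`. -/
def IsCrep (Q : Quiv) (S : Set (PathDat Q)) (Pred : PathDat Q → Prop) : Prop :=
  ∃ P : Set (PathDat Q),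
    IsRepSet Q P (fun p => IsPrimitive Q p ∧ Pred p) ∧
    S = {x | ∃ p ∈ P, ∃ n : ℕ, 1 ≤ n ∧ x = powP Q p n}

/-! ### The cochain complex `k(Γ ∥ B)` -/

/-- Membership in the degree-`m` basis `Γ_m ∥ B` of the cochain complex. -/
def GBmem (Q : Quiv) (R : Set (Q.A × Q.A)) (m : ℕ) (x : PathDat Q × PathDat Q) : Prop :=
  InG Q R x.1 ∧ plen Q x.1 = m ∧ InB Q R x.2 ∧ Par Q x.1 x.2

abbrev GB (Q : Quiv) (R : Set (Q.A × Q.A)) (m : ℕ) :=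
  {x : PathDat Q × PathDat Q // GBmem Q R m x}

/-- The degree-`m` component of the cochain complex `k(Γ ∥ B)`. -/
abbrev Coch (k : Type) [Field k] (Q : Quiv) (R : Set (Q.A × Q.A)) (m : ℕ) :=
  GB Q R m →₀ k

/-- The basis vector of `k(Γ_m ∥ B)` attached to a raw pair of path data
(and `0` if the pair is not in `Γ_m ∥ B`). -/
noncomputable def bv (k : Type) [Field k] (Q : Quiv) (R : Set (Q.A × Q.A)) (m : ℕ)
    (x : PathDat Q × PathDat Q) : Coch k Q R m := by
  classical
  exact if h : GBmem Q R m x then Finsupp.single (⟨x, h⟩ : GB Q R m) (1 : k) else 0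

/-- Extension on the left (in the paper's notation): `p ↦ b p`. -/
def extL (Q : Quiv) (b : Q.A) (p : PathDat Q) : PathDat Q := (p.1, p.2 ++ [b])

/-- Extension on the right (in the paper's notation): `p ↦ p a`. -/
def extR (Q : Quiv) (a : Q.A) (p : PathDat Q) : PathDat Q := (Q.src a, a :: p.2)

/-- The differential on a basis element:
`d^m (γ, α) = Σ_b (bγ, bα) - (-1)^m Σ_a (γa, αa)`. -/
noncomputable def dB (k : Type) [Field k] (Q : Quiv) (R : Set (Q.A × Q.A)) (m : ℕ)
    (x : GB Q R m) : Coch k Q R (m + 1) := by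
  classical
  exact
    (∑ b : Q.A,
      if h : GBmem Q R (m + 1) (extL Q b x.val.1, extL Q b x.val.2) then
        Finsupp.single (⟨_, h⟩ : GB Q R (m + 1)) (1 : k) else 0)
    - ((-1 : k) ^ m) •
      (∑ a : Q.A,
        if h : Q.tgt a = psrc Q x.val.1 ∧
            GBmem Q R (m + 1) (extR Q a x.val.1, extR Q a x.val.2) then
          Finsupp.single (⟨_, h.2⟩ : GB Q R (m + 1)) (1 : k) else 0)

/-- The differential `d^m : k(Γ_m ∥ B) → k(Γ_{m+1} ∥ B)`. -/
noncomputable def dLin (k : Type) [Field k] (Q : Quiv) (R : Set (Q.A × Q.A)) (m : ℕ) :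
    Coch k Q R m →ₗ[k] Coch k Q R (m + 1) :=
  Finsupp.linearCombination k (dB k Q R m)

/-- The element `𝟙 = Σ_{i ∈ Q₀} (e_i, e_i)` (placed in degree `m`; it is the
intended element when `m = 0`). -/
noncomputable def oneD (k : Type) [Field k] (Q : Quiv) (R : Set (Q.A × Q.A)) (m : ℕ) :
    Coch k Q R m :=
  ∑ i : Q.V, bv k Q R m ((i, []), (i, []))

/-- `⟨α⟩ = Σ_{i=0}^{r-1} (s(rot^i α), rot^i α)`, `r` the period of `α`. -/
noncomputable def cycB (k : Type) [Field k] (Q : Quiv) (R : Set (Q.A × Q.A)) (m : ℕ)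
    (α : PathDat Q) : Coch k Q R m :=
  ∑ i ∈ Finset.range (periodP Q α),
    bv k Q R m ((psrc Q (rotI Q i α), []), rotI Q i α)

/-- `⟨C⟩ = Σ_{i=0}^{r-1} (-1)^{i m} (rot^i C, s(rot^i C))`, `r` the period of `C`. -/
noncomputable def cycG (k : Type) [Field k] (Q : Quiv) (R : Set (Q.A × Q.A)) (m : ℕ)
    (C : PathDat Q) : Coch k Q R m :=
  ∑ i ∈ Finset.range (periodP Q C),
    ((-1 : k) ^ (i * m)) • bv k Q R m (rotI Q i C, (psrc Q (rotI Q i C), []))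

/-- The coboundary subspace in degree `m` (zero in degree `0`). -/
noncomputable def cobSp (k : Type) [Field k] (Q : Quiv) (R : Set (Q.A × Q.A)) :
    (m : ℕ) → Submodule k (Coch k Q R m)
  | 0 => ⊥
  | m + 1 => LinearMap.range (dLin k Q R m)

/-- The cocycle subspace in degree `m`. -/
noncomputable def cocSp (k : Type) [Field k] (Q : Quiv) (R : Set (Q.A × Q.A)) (m : ℕ) :
    Submodule k (Coch k Q R m) :=
  LinearMap.ker (dLin k Q R m)

/-- The degree-`m` cohomology `HH^m` of the complex `k(Γ ∥ B)` vanishes: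
every cocycle is a coboundary. -/
def CohomIsZero (k : Type) [Field k] (Q : Quiv) (R : Set (Q.A × Q.A)) (m : ℕ) : Prop :=
  cocSp k Q R m ≤ cobSp k Q R m

/-- The degree-`m` cohomology `HH^m` of the complex `k(Γ ∥ B)` is
finite-dimensional: there is a finite set of cocycles whose classes span it. -/
def CohomFinDim (k : Type) [Field k] (Q : Quiv) (R : Set (Q.A × Q.A)) (m : ℕ) : Prop :=
  ∃ G : Finset (Coch k Q R m), ↑G ⊆ (cocSp k Q R m : Set (Coch k Q R m)) ∧
    cocSp k Q R m ≤ cobSp k Q R m ⊔ Submodule.span k ↑G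

/-- The degree-`m` cohomology `HH^m` of the complex `k(Γ ∥ B)` has dimension at
most `n`: there are `n` cocycles whose classes span it. -/
def CohomDimLe (k : Type) [Field k] (Q : Quiv) (R : Set (Q.A × Q.A)) (m n : ℕ) : Prop :=
  ∃ G : Finset (Coch k Q R m), G.card ≤ n ∧
    ↑G ⊆ (cocSp k Q R m : Set (Coch k Q R m)) ∧
    cocSp k Q R m ≤ cobSp k Q R m ⊔ Submodule.span k ↑G

/-- `Gen` is a basis of the kernel of `d⁰`, i.e. it freely generates `HH⁰`. -/
def FreelyGeneratesKer0 (k : Type) [Field k] (Q : Quiv) (R : Set (Q.A × Q.A))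
    (Gen : Set (Coch k Q R 0)) : Prop :=
  (∀ x ∈ Gen, dLin k Q R 0 x = 0) ∧
  (∀ z : Coch k Q R 0, dLin k Q R 0 z = 0 → z ∈ Submodule.span k Gen) ∧
  LinearIndependent k (fun x : Gen => (x : Coch k Q R 0))

/-- The cohomology classes of the elements of `Gen` freely generate the
degree-`(m+1)` cohomology of `k(Γ ∥ B)`: all elements of `Gen` are cocycles,
every cocycle is congruent to an element of their span modulo coboundaries, no
nonzero element of their span is a coboundary, and `Gen` is linearly
independent. -/
def FreelyGeneratesCohom (k : Type) [Field k] (Q : Quiv) (R : Set (Q.A × Q.A)) (m : ℕ)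
    (Gen : Set (Coch k Q R (m + 1))) : Prop :=
  (∀ x ∈ Gen, dLin k Q R (m + 1) x = 0) ∧
  (∀ z : Coch k Q R (m + 1), dLin k Q R (m + 1) z = 0 →
      ∃ y : Coch k Q R m, z - dLin k Q R m y ∈ Submodule.span k Gen) ∧
  (∀ x ∈ Submodule.span k Gen, x ∈ LinearMap.range (dLin k Q R m) → x = 0) ∧
  LinearIndependent k (fun x : Gen => (x : Coch k Q R (m + 1)))

/-! ### The chain complex `k(B ⊙ Γ)` -/

/-- Membership in the degree-`m` basis `B ⊙ Γ_m` of the chain complex. -/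
def BGmem (Q : Quiv) (R : Set (Q.A × Q.A)) (m : ℕ) (x : PathDat Q × PathDat Q) : Prop :=
  InB Q R x.1 ∧ InG Q R x.2 ∧ plen Q x.2 = m ∧ AntiPar Q x.1 x.2

abbrev BGt (Q : Quiv) (R : Set (Q.A × Q.A)) (m : ℕ) :=
  {x : PathDat Q × PathDat Q // BGmem Q R m x}

/-- The degree-`m` component of the chain complex `k(B ⊙ Γ)`. -/
abbrev Chn (k : Type) [Field k] (Q : Quiv) (R : Set (Q.A × Q.A)) (m : ℕ) :=
  BGt Q R m →₀ k

/-- The basis vector of `k(B ⊙ Γ_m)` attached to a raw pair of path data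
(and `0` if the pair is not in `B ⊙ Γ_m`). -/
noncomputable def bw (k : Type) [Field k] (Q : Quiv) (R : Set (Q.A × Q.A)) (m : ℕ)
    (x : PathDat Q × PathDat Q) : Chn k Q R m := by
  classical
  exact if h : BGmem Q R m x then Finsupp.single (⟨x, h⟩ : BGt Q R m) (1 : k) else 0

/-- `l1(p)`: the last arrow of `p` (as a path of length one). -/
def l1P (Q : Quiv) (p : PathDat Q) : PathDat Q :=
  match p.2.getLast? with
  | none => p
  | some a => (Q.src a, [a])

/-- `l2(p)`: `p` with its last arrow removed. -/
def l2P (Q : Quiv) (p : PathDat Q) : PathDat Q := (p.1, p.2.dropLast)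

/-- `r1(p)`: `p` with its first arrow removed. -/
def r1P (Q : Quiv) (p : PathDat Q) : PathDat Q :=
  match p.2 with
  | [] => p
  | a :: l => (Q.tgt a, l)

/-- `r2(p)`: the first arrow of `p` (as a path of length one). -/
def r2P (Q : Quiv) (p : PathDat Q) : PathDat Q :=
  match p.2 with
  | [] => p
  | a :: _ => (Q.src a, [a])

/-- The raw first term `(α·l1(γ), l2(γ))` of the boundary of `(α, γ)`. -/
def d1raw (Q : Quiv) (x : PathDat Q × PathDat Q) : PathDat Q × PathDat Q :=
  match x.2.2.getLast? with
  | none => x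
  | some a => ((Q.src a, a :: x.1.2), (x.2.1, x.2.2.dropLast))

/-- The raw second term `(r2(γ)·α, r1(γ))` of the boundary of `(α, γ)`. -/
def d2raw (Q : Quiv) (x : PathDat Q × PathDat Q) : PathDat Q × PathDat Q :=
  match x.2.2 with
  | [] => x
  | c :: l => ((x.1.1, x.1.2 ++ [c]), (Q.tgt c, l))

/-- The boundary of a basis element:
`d_m (α, γ) = (α·l1(γ), l2(γ)) + (-1)^m (r2(γ)·α, r1(γ))` (in degree `m = m+1`),
where pairs whose first component is not in `B` are interpreted as `0`. -/
noncomputable def bdB (k : Type) [Field k] (Q : Quiv) (R : Set (Q.A × Q.A)) (m : ℕ)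
    (x : BGt Q R (m + 1)) : Chn k Q R m :=
  bw k Q R m (d1raw Q x.val) + ((-1 : k) ^ (m + 1)) • bw k Q R m (d2raw Q x.val)

/-- The boundary map `d_{m+1} : k(B ⊙ Γ_{m+1}) → k(B ⊙ Γ_m)`. -/
noncomputable def bd (k : Type) [Field k] (Q : Quiv) (R : Set (Q.A × Q.A)) (m : ℕ) :
    Chn k Q R (m + 1) →ₗ[k] Chn k Q R m :=
  Finsupp.linearCombination k (bdB k Q R m)

/-- The subspace of cycles in degree `m` (everything in degree `0`). -/
noncomputable def ZSp (k : Type) [Field k] (Q : Quiv) (R : Set (Q.A × Q.A)) :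
    (m : ℕ) → Submodule k (Chn k Q R m)
  | 0 => ⊤
  | m + 1 => LinearMap.ker (bd k Q R m)

/-- The subspace of boundaries in degree `m`. -/
noncomputable def BSp (k : Type) [Field k] (Q : Quiv) (R : Set (Q.A × Q.A)) (m : ℕ) :
    Submodule k (Chn k Q R m) :=
  LinearMap.range (bd k Q R m)

/-- The degree-`m` homology `HH_m` of the complex `k(B ⊙ Γ)` vanishes:
every cycle is a boundary. -/
def HomIsZero (k : Type) [Field k] (Q : Quiv) (R : Set (Q.A × Q.A)) (m : ℕ) : Prop :=
  ZSp k Q R m ≤ BSp k Q R m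

/-- The degree-`m` homology `HH_m` of the complex `k(B ⊙ Γ)` is
finite-dimensional: there is a finite set of cycles whose classes span it. -/
def HomFinDim (k : Type) [Field k] (Q : Quiv) (R : Set (Q.A × Q.A)) (m : ℕ) : Prop :=
  ∃ G : Finset (Chn k Q R m), ↑G ⊆ (ZSp k Q R m : Set (Chn k Q R m)) ∧
    ZSp k Q R m ≤ BSp k Q R m ⊔ Submodule.span k ↑G

/-- The concatenation `α γ` of an antiparallel pair (a cycle, or a trivial path). -/
def concatP (Q : Quiv) (x : PathDat Q × PathDat Q) : PathDat Q := (x.2.1, x.2.2 ++ x.1.2)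

/-- The degree-`m` component of the subcomplex `k(B ⊙ Γ)_C`, spanned by the
basis elements whose concatenation lies in the circuit (rotation class) of `c`. -/
noncomputable def Wsp (k : Type) [Field k] (Q : Quiv) (R : Set (Q.A × Q.A))
    (c : PathDat Q) (m : ℕ) : Submodule k (Chn k Q R m) :=
  Submodule.span k {z : Chn k Q R m |
    ∃ x : BGt Q R m, RotEquiv Q (concatP Q x.val) c ∧ z = Finsupp.single x (1 : k)}

/-- The boundaries of the subcomplex `k(B ⊙ Γ)_C` in degree `m`. -/
noncomputable def WB (k : Type) [Field k] (Q : Quiv) (R : Set (Q.A × Q.A))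
    (c : PathDat Q) (m : ℕ) : Submodule k (Chn k Q R m) :=
  Submodule.map (bd k Q R m) (Wsp k Q R c (m + 1))

/-- The cycles of the subcomplex `k(B ⊙ Γ)_C` in degree `m`. -/
noncomputable def WZ (k : Type) [Field k] (Q : Quiv) (R : Set (Q.A × Q.A))
    (c : PathDat Q) (m : ℕ) : Submodule k (Chn k Q R m) :=
  ZSp k Q R m ⊓ Wsp k Q R c m

/-- The degree-`m` homology of `k(B ⊙ Γ)_C` is one-dimensional, spanned by the
homology class of `v`. -/
def SubHomSpannedBy (k : Type) [Field k] (Q : Quiv) (R : Set (Q.A × Q.A))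
    (c : PathDat Q) (m : ℕ) (v : Chn k Q R m) : Prop :=
  v ∈ WZ k Q R c m ∧ v ∉ WB k Q R c m ∧
  ∀ z ∈ WZ k Q R c m, ∃ t : k, z - t • v ∈ WB k Q R c m

/-- `ĥ(c) = Σ_{i=0}^{r-1} (r1(rot^i c), r2(rot^i c))` (degree 1, for cocomplete cycles;
placed in degree `m`). -/
noncomputable def hCycR (k : Type) [Field k] (Q : Quiv) (R : Set (Q.A × Q.A)) (m : ℕ)
    (c : PathDat Q) : Chn k Q R m :=
  ∑ i ∈ Finset.range (periodP Q c),
    bw k Q R m (r1P Q (rotI Q i c), r2P Q (rotI Q i c))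

/-- `ĥ(c) = Σ_{i=0}^{r-1} (-1)^{(m+1) i} (s(rot^i c), rot^i c)` (degree `m`, for
complete cycles of length `m`). -/
noncomputable def hCycM (k : Type) [Field k] (Q : Quiv) (R : Set (Q.A × Q.A)) (m : ℕ)
    (c : PathDat Q) : Chn k Q R m :=
  ∑ i ∈ Finset.range (periodP Q c),
    ((-1 : k) ^ ((m + 1) * i)) • bw k Q R m ((psrc Q (rotI Q i c), []), rotI Q i c)

/-- The homology classes of the elements of `Gen` freely generate the degree-`m`
homology of `k(B ⊙ Γ)`. -/
def FreelyGeneratesHom (k : Type) [Field k] (Q : Quiv) (R : Set (Q.A × Q.A)) (m : ℕ)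
    (Gen : Set (Chn k Q R m)) : Prop :=
  (∀ x ∈ Gen, x ∈ ZSp k Q R m) ∧
  (∀ z ∈ ZSp k Q R m, ∃ y : Chn k Q R (m + 1), z - bd k Q R m y ∈ Submodule.span k Gen) ∧
  (∀ x ∈ Submodule.span k Gen, x ∈ LinearMap.range (bd k Q R m) → x = 0) ∧
  LinearIndependent k (fun x : Gen => (x : Chn k Q R m))

section helpers

theorem homFin_of_le (k : Type) [Field k] (Q : Quiv) (R : Set (Q.A × Q.A)) (m : ℕ)
    (W : Submodule k (Chn k Q R m)) [FiniteDimensional k W]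
    (h : ZSp k Q R m ≤ BSp k Q R m ⊔ W) : HomFinDim k Q R m := by
  classical
  set Z := ZSp k Q R m
  set B := BSp k Q R m
  have hfd : FiniteDimensional k (Z.map B.mkQ) := by
    have h1 : Z.map B.mkQ ≤ W.map B.mkQ := by
      refine (Submodule.map_mono h).trans ?_
      rw [Submodule.map_sup]
      simp [Submodule.mkQ_map_self]
    exact Submodule.finiteDimensional_of_le h1
  have hfg : (Z.map B.mkQ).FG := (Submodule.fg_iff_finiteDimensional _).2 hfd
  obtain ⟨S, hS⟩ := hfg
  have hsub : ∀ s : S, ∃ z ∈ Z, B.mkQ z = s := by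
    intro s
    have : (s : Chn k Q R m ⧸ B) ∈ Z.map B.mkQ := by
      rw [← hS]; exact Submodule.subset_span s.2
    simpa using this
  choose f hf hf' using hsub
  refine ⟨Finset.univ.image f, ?_, ?_⟩
  · intro x hx
    simp only [Finset.coe_image, Finset.coe_univ, Set.image_univ, Set.mem_range] at hx
    obtain ⟨s, rfl⟩ := hx
    exact hf s
  · have key : Z.map B.mkQ ≤ (Submodule.span k (↑(Finset.univ.image f) : Set (Chn k Q R m))).map B.mkQ := by
      rw [← hS, Submodule.span_le]
      intro s hs
      refine ⟨f ⟨s, hs⟩, Submodule.subset_span ?_, hf' _⟩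
      simp
    have := Submodule.map_le_iff_le_comap.1 key
    rw [Submodule.comap_map_mkQ] at this
    exact this

theorem bd_bw (k : Type) [Field k] (Q : Quiv) (R : Set (Q.A × Q.A)) (m : ℕ)
    (y : PathDat Q × PathDat Q) (hy : BGmem Q R (m + 1) y) :
    bd k Q R m (bw k Q R (m + 1) y) =
      bw k Q R m (d1raw Q y) + ((-1 : k) ^ (m + 1)) • bw k Q R m (d2raw Q y) := by
  simp [bd, bw, hy, bdB]

theorem bw_zero (k : Type) [Field k] (Q : Quiv) (R : Set (Q.A × Q.A)) (m : ℕ)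
    (y : PathDat Q × PathDat Q) (hy : ¬ BGmem Q R m y) : bw k Q R m y = 0 := by
  simp [bw, hy]

theorem bw_val (k : Type) [Field k] (Q : Quiv) (R : Set (Q.A × Q.A)) (m : ℕ)
    (y : BGt Q R m) : bw k Q R m y.1 = Finsupp.single y 1 := by
  simp [bw, y.2]

/-- move the first arrow of `α` to the end of `γ` -/
def hraw (Q : Quiv) (x : PathDat Q × PathDat Q) : PathDat Q × PathDat Q :=
  match x.1.2 with
  | [] => x
  | a :: l => ((Q.tgt a, l), (x.2.1, x.2.2 ++ [a]))

noncomputable def hL (k : Type) [Field k] (Q : Quiv) (R : Set (Q.A × Q.A)) (m : ℕ) :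
    Chn k Q R m →ₗ[k] Chn k Q R (m + 1) :=
  Finsupp.linearCombination k (fun x => bw k Q R (m + 1) (hraw Q x.1))

theorem hL_bw (k : Type) [Field k] (Q : Quiv) (R : Set (Q.A × Q.A)) (m : ℕ)
    (y : PathDat Q × PathDat Q) (hy : BGmem Q R m y) :
    hL k Q R m (bw k Q R m y) = bw k Q R (m + 1) (hraw Q y) := by
  simp [hL, bw, hy]

/-- Characterisation of membership for pairs with both components nontrivial. -/
theorem BGmem_iff (Q : Quiv) (R : Set (Q.A × Q.A)) (m : ℕ) (u v : Q.V) (α γ : List Q.A) :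
    BGmem Q R m ((u, α), (v, γ)) ↔
      (α.IsChain (fun a b => Q.tgt a = Q.src b) ∧ (∀ a ∈ α.head?, Q.src a = u) ∧
        α.IsChain (fun a b => (a, b) ∉ R)) ∧
      (γ.IsChain (fun a b => Q.tgt a = Q.src b) ∧ (∀ a ∈ γ.head?, Q.src a = v) ∧
        γ.IsChain (fun a b => (a, b) ∈ R)) ∧ γ.length = m ∧
      u = γ.getLast?.elim v Q.tgt ∧ α.getLast?.elim u Q.tgt = v := by
  simp only [BGmem, InB, InG, Ok, AntiPar, psrc, ptgt, plen, and_assoc]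
  exact Iff.rfl

theorem homotopy (k : Type) [Field k] (Q : Quiv) (R : Set (Q.A × Q.A)) (m : ℕ)
    (x : BGt Q R (m + 2)) (hx : 2 ≤ x.1.1.2.length) :
    bd k Q R (m + 2) (hL k Q R (m + 2) (Finsupp.single x 1)) +
      hL k Q R (m + 1) (bd k Q R (m + 1) (Finsupp.single x 1)) = Finsupp.single x 1 := by
  rw [← bw_val]
  obtain ⟨⟨⟨u, α⟩, ⟨v, γ⟩⟩, hm⟩ := x
  simp only at hx ⊢
  obtain ⟨a, l, b, rfl⟩ : ∃ a l b, α = a :: (l ++ [b]) := by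
    match α, hx with
    | a :: a' :: l, _ =>
      exact ⟨a, (a' :: l).dropLast, (a' :: l).getLast (by simp), by
        rw [List.dropLast_append_getLast]⟩
  have hlen : γ.length = m + 2 := hm.2.2.1
  obtain ⟨c, g, e, rfl⟩ : ∃ a l b, γ = a :: (l ++ [b]) := by
    match γ, hlen with
    | a :: a' :: l, _ =>
      exact ⟨a, (a' :: l).dropLast, (a' :: l).getLast (by simp), by
        rw [List.dropLast_append_getLast]⟩
  rw [hL_bw _ _ _ _ _ hm, bd_bw _ _ _ _ _ hm]
  have e1 : d1raw Q ((u, a :: (l ++ [b])), (v, c :: (g ++ [e]))) =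
      ((Q.src e, e :: a :: (l ++ [b])), (v, c :: g)) := by
    have : c :: (g ++ [e]) = (c :: g) ++ [e] := rfl
    simp only [d1raw, this, List.getLast?_concat, List.dropLast_concat]
  have e2 : d2raw Q ((u, a :: (l ++ [b])), (v, c :: (g ++ [e]))) =
      ((u, a :: (l ++ [b, c])), (Q.tgt c, g ++ [e])) := by
    simp [d2raw]
  have e3 : hraw Q ((u, a :: (l ++ [b])), (v, c :: (g ++ [e]))) =
      ((Q.tgt a, l ++ [b]), (v, c :: (g ++ [e, a]))) := by
    simp [hraw]
  have e4 : d1raw Q ((Q.tgt a, l ++ [b]), (v, c :: (g ++ [e, a]))) =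
      ((Q.src a, a :: (l ++ [b])), (v, c :: (g ++ [e]))) := by
    have : c :: (g ++ [e, a]) = (c :: (g ++ [e])) ++ [a] := by simp
    simp only [d1raw, this, List.getLast?_concat, List.dropLast_concat]
  have e5 : d2raw Q ((Q.tgt a, l ++ [b]), (v, c :: (g ++ [e, a]))) =
      ((Q.tgt a, l ++ [b, c]), (Q.tgt c, g ++ [e, a])) := by
    simp [d2raw]
  have e6 : hraw Q ((Q.src e, e :: a :: (l ++ [b])), (v, c :: g)) =
      ((Q.tgt e, a :: (l ++ [b])), (v, c :: (g ++ [e]))) := by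
    simp [hraw]
  have e7 : hraw Q ((u, a :: (l ++ [b, c])), (Q.tgt c, g ++ [e])) =
      ((Q.tgt a, l ++ [b, c]), (Q.tgt c, g ++ [e, a])) := by
    simp [hraw]
  have m1 : BGmem Q R (m + 1) ((Q.src e, e :: a :: (l ++ [b])), (v, c :: g)) ↔ (e, a) ∉ R := by
    clear * - hm
    rw [BGmem_iff] at hm ⊢
    cases l <;> cases g using List.reverseRecOn <;>
      simp_all [List.isChain_append, List.getLast?_cons, List.isChain_cons] <;> grind
  have m2 : BGmem Q R (m + 1) ((u, a :: (l ++ [b, c])), (Q.tgt c, g ++ [e])) ↔ (b, c) ∉ R := by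
    clear * - hm
    rw [BGmem_iff] at hm ⊢
    cases l <;> cases g <;>
      simp_all [List.isChain_append, List.getLast?_cons, List.isChain_cons] <;> grind
  have m3 : BGmem Q R (m + 3) ((Q.tgt a, l ++ [b]), (v, c :: (g ++ [e, a]))) ↔ (e, a) ∈ R := by
    clear * - hm
    rw [BGmem_iff] at hm ⊢
    cases l <;> cases g <;>
      simp_all [List.isChain_append, List.getLast?_cons, List.isChain_cons] <;> grind
  have m4 : BGmem Q R (m + 2) ((Q.tgt a, l ++ [b, c]), (Q.tgt c, g ++ [e, a])) ↔
      (e, a) ∈ R ∧ (b, c) ∉ R := by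
    clear * - hm
    rw [BGmem_iff] at hm ⊢
    cases l <;> cases g <;>
      simp_all [List.isChain_append, List.getLast?_cons, List.isChain_cons] <;> grind
  have hu : Q.src a = u ∧ Q.tgt e = u := by
    clear * - hm
    rw [BGmem_iff] at hm
    simp_all [List.getLast?_cons]
  rw [e1, e2, e3]
  by_cases p : (e, a) ∈ R
  · rw [bd_bw _ _ _ _ _ (m3.2 p), e4, e5, bw_zero _ _ _ _ _ (fun h => m1.1 h p), hu.1]
    by_cases q : (b, c) ∈ R
    · rw [bw_zero _ _ _ _ _ (fun h => m2.1 h q), bw_zero _ _ _ _ _ (fun h => (m4.1 h).2 q)]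
      simp
    · rw [map_add, map_smul, hL_bw _ _ _ _ _ (m2.2 q), e7]
      rw [pow_succ (-1 : k) (m + 2)]
      simp
  · rw [bw_zero _ _ _ _ _ (fun h => p (m3.1 h)), map_zero, map_add, map_smul,
      hL_bw _ _ _ _ _ (m1.2 p), e6, hu.2]
    by_cases q : (b, c) ∈ R
    · rw [bw_zero _ _ _ _ _ (fun h => m2.1 h q)]
      simp
    · rw [hL_bw _ _ _ _ _ (m2.2 q), e7, bw_zero _ _ _ _ _ (fun h => p (m4.1 h).1)]
      simp

theorem finite_pathDat (Q : Quiv) (n : ℕ) : {p : PathDat Q | p.2.length ≤ n}.Finite := by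
  refine ((Set.finite_univ (α := Q.V)).prod (List.finite_length_le Q.A n)).subset ?_
  intro p hp
  exact ⟨trivial, hp⟩

theorem finite_small (Q : Quiv) (R : Set (Q.A × Q.A)) (m n : ℕ) :
    {x : BGt Q R m | x.1.1.2.length ≤ n}.Finite := by
  have h := (finite_pathDat Q n).prod (finite_pathDat Q m)
  refine Set.Finite.of_finite_image (f := Subtype.val) (h.subset ?_) Subtype.val_injective.injOn
  rintro _ ⟨x, hx, rfl⟩
  exact ⟨hx, x.2.2.2.1.le⟩

theorem homFin_ge_two (k : Type) [Field k] (Q : Quiv) (R : Set (Q.A × Q.A)) (m : ℕ) :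
    HomFinDim k Q R (m + 2) := by
  set E : Chn k Q R (m + 2) →ₗ[k] Chn k Q R (m + 2) :=
    (bd k Q R (m + 2)) ∘ₗ (hL k Q R (m + 2)) + (hL k Q R (m + 1)) ∘ₗ (bd k Q R (m + 1))
      - LinearMap.id with hE
  have hfin := (finite_small Q R (m + 2) 1).image (fun x => E (Finsupp.single x 1))
  set W := Submodule.span k
    ((fun x => E (Finsupp.single x 1)) '' {x : BGt Q R (m + 2) | x.1.1.2.length ≤ 1}) with hW
  have : FiniteDimensional k W := FiniteDimensional.span_of_finite k hfin
  have hEW : ∀ z, E z ∈ W := by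
    intro z
    induction z using Finsupp.induction_linear with
    | zero => simp
    | add f g hf hg => rw [map_add]; exact W.add_mem hf hg
    | single x c =>
      have : Finsupp.single x c = c • Finsupp.single x (1 : k) := by simp
      rw [this, map_smul]
      apply W.smul_mem
      by_cases hx : x.1.1.2.length ≤ 1
      · exact Submodule.subset_span ⟨x, hx, rfl⟩
      · have := homotopy k Q R m x (by omega)
        have h0 : E (Finsupp.single x 1) = 0 := by
          simp only [hE, LinearMap.sub_apply, LinearMap.add_apply, LinearMap.comp_apply,
            LinearMap.id_apply]
          rw [this, sub_self]
        rw [h0]; exact W.zero_mem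
  refine homFin_of_le k Q R (m + 2) W ?_
  intro z hz
  have hz' : bd k Q R (m + 1) z = 0 := hz
  have h1 : E z = bd k Q R (m + 2) (hL k Q R (m + 2) z) - z := by
    simp [hE, hz']
  have h2 : z = bd k Q R (m + 2) (hL k Q R (m + 2) z) + (- E z) := by
    rw [h1]; abel
  rw [h2]
  exact Submodule.add_mem_sup ⟨_, rfl⟩ (W.neg_mem (hEW z))

theorem homFin_of_finite (k : Type) [Field k] (Q : Quiv) (R : Set (Q.A × Q.A)) (m : ℕ)
    (h : {p : PathDat Q | InB Q R p}.Finite) : HomFinDim k Q R m := by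
  have h2 := h.prod (finite_pathDat Q m)
  have : Finite (BGt Q R m) := by
    refine Set.Finite.subset h2 ?_
    intro x hx
    exact ⟨hx.1, hx.2.2.1.le⟩
  exact homFin_of_le k Q R m ⊤ (by simp)

/-- composable with zero relation absent -/
def rel (Q : Quiv) (R : Set (Q.A × Q.A)) (a b : Q.A) : Prop := Q.tgt a = Q.src b ∧ (a, b) ∉ R

/-- Cyclic words of length `N` none of whose cyclic length-2 subwords is in `R`. -/
def CW (Q : Quiv) (R : Set (Q.A × Q.A)) (N : ℕ) : Set (List Q.A) :=
  {w | w.length = N ∧ Cycle.Chain (rel Q R) (w : Cycle Q.A)}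

theorem CW_finite (Q : Quiv) (R : Set (Q.A × Q.A)) (N : ℕ) : (CW Q R N).Finite :=
  (List.finite_length_eq Q.A N).subset fun _ hw => hw.1

theorem CW_rotate (Q : Quiv) (R : Set (Q.A × Q.A)) (N : ℕ) (a : Q.A) (l : List Q.A) :
    l ++ [a] ∈ CW Q R N ↔ a :: l ∈ CW Q R N := by
  simp only [CW, Set.mem_ofPred_eq, List.length_append, List.length_cons, List.length_nil]
  rw [Cycle.coe_cons_eq_coe_append]

theorem isChain_rel (Q : Quiv) (R : Set (Q.A × Q.A)) (l : List Q.A) :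
    l.IsChain (rel Q R) ↔ l.IsChain (fun a b => Q.tgt a = Q.src b) ∧
      l.IsChain (fun a b => (a, b) ∉ R) := by
  simp only [List.isChain_iff_getElem, rel]
  exact ⟨fun h => ⟨fun i hi => (h i hi).1, fun i hi => (h i hi).2⟩,
    fun h i hi => ⟨h.1 i hi, h.2 i hi⟩⟩

theorem exists_CW (Q : Quiv) (R : Set (Q.A × Q.A))
    (h : ¬ {p : PathDat Q | InB Q R p}.Finite) (M : ℕ) :
    ∃ N, M ≤ N ∧ 1 ≤ N ∧ (CW Q R N).Nonempty := by
  set M' := M + 1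
  obtain ⟨p, hp, hl⟩ : ∃ p, InB Q R p ∧ Fintype.card Q.A * M' < p.2.length := by
    by_contra! hcon
    exact h ((finite_pathDat Q _).subset fun p hp => hcon p hp)
  obtain ⟨v, l⟩ := p
  simp only at hl
  have hch : l.IsChain (rel Q R) := (isChain_rel Q R l).2 ⟨hp.1.1, hp.2⟩
  have hlt : ∀ i : Fin (Fintype.card Q.A + 1), i.1 * M' < l.length := fun i =>
    lt_of_le_of_lt (Nat.mul_le_mul_right _ (Nat.lt_succ_iff.1 i.2)) hl
  obtain ⟨i, j, hij, heq⟩ : ∃ i j : Fin (Fintype.card Q.A + 1), i < j ∧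
      l[i.1 * M']'(hlt i) = l[j.1 * M']'(hlt j) := by
    obtain ⟨i, j, hne, he⟩ := Fintype.exists_ne_map_eq_of_card_lt
      (fun i : Fin (Fintype.card Q.A + 1) => l[i.1 * M']'(hlt i)) (by simp)
    rcases lt_or_gt_of_ne hne with h | h
    · exact ⟨i, j, h, he⟩
    · exact ⟨j, i, h, he.symm⟩
  have hjM : i.1 * M' + M' ≤ j.1 * M' := by
    have : (i.1 + 1) * M' ≤ j.1 * M' := Nat.mul_le_mul_right _ hij
    linarith [Nat.succ_mul i.1 M']
  obtain ⟨I, J, hIJ, hIl, hJl, heq⟩ : ∃ (I J : ℕ) (_ : I + M' ≤ J) (hI : I < l.length)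
      (hJ : J < l.length), l[I] = l[J] := ⟨_, _, hjM, hlt i, hlt j, heq⟩
  refine ⟨J - I, by omega, by omega, (l.drop I).take (J - I), ?_, ?_⟩
  · simp; omega
  · have h1 : (l.drop I).take (J - I) = l[I] :: (l.drop (I + 1)).take (J - I - 1) := by
      rw [List.drop_eq_getElem_cons hIl]
      obtain ⟨t, ht⟩ : ∃ t, J - I = t + 1 := ⟨J - I - 1, by omega⟩
      rw [ht, List.take_succ_cons, Nat.add_sub_cancel]
    rw [h1, Cycle.chain_coe_cons, ← List.cons_append, ← h1, heq]
    have h2 : (l.drop I).take (J - I) ++ [l[J]] = (l.drop I).take (J - I + 1) := by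
      rw [List.take_succ_eq_append_getElem (by simp; omega)]
      congr 2
      simp only [List.getElem_drop]
      congr 1
      omega
    rw [h2]
    exact hch.infix ((List.take_prefix _ _).isInfix.trans (List.drop_suffix _ _).isInfix)

theorem CW_cons (Q : Quiv) (R : Set (Q.A × Q.A)) (N : ℕ) (a : Q.A) (l : List Q.A) :
    a :: l ∈ CW Q R N ↔ l.length + 1 = N ∧ (a :: (l ++ [a])).IsChain (fun a b => Q.tgt a = Q.src b) ∧
      (a :: (l ++ [a])).IsChain (fun a b => (a, b) ∉ R) := by
  simp only [CW, Set.mem_ofPred_eq, List.length_cons, Cycle.chain_coe_cons, isChain_rel]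

/-- a cyclic word gives a degree-0 basis element -/
theorem CW_mem0 (Q : Quiv) (R : Set (Q.A × Q.A)) (N : ℕ) (a : Q.A) (l : List Q.A)
    (h : a :: l ∈ CW Q R N) : BGmem Q R 0 ((Q.src a, a :: l), (Q.src a, [])) := by
  rw [CW_cons] at h
  rw [BGmem_iff]
  cases l using List.reverseRecOn <;> simp_all [List.isChain_append, List.getLast?_cons, List.isChain_cons] <;> grind

theorem CW_mem0' (Q : Quiv) (R : Set (Q.A × Q.A)) (N : ℕ) (a : Q.A) (l : List Q.A)
    (h : a :: l ∈ CW Q R N) (v : Q.V) (hv : ∀ b ∈ (l ++ [a]).head?, Q.src b = v) :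
    BGmem Q R 0 ((v, l ++ [a]), (Q.tgt a, [])) := by
  rw [CW_cons] at h
  rw [BGmem_iff]
  cases l <;> simp_all [List.isChain_append, List.getLast?_cons, List.isChain_cons] <;> grind

/-- a cyclic word gives a degree-1 basis element -/
theorem CW_mem1 (Q : Quiv) (R : Set (Q.A × Q.A)) (N : ℕ) (a : Q.A) (l : List Q.A)
    (h : a :: l ∈ CW Q R N) : BGmem Q R 1 ((Q.tgt a, l), (Q.src a, [a])) := by
  rw [CW_cons] at h
  rw [BGmem_iff]
  cases l using List.reverseRecOn with
  | nil => simp_all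
  | append_singleton l b =>
    cases l <;> simp [List.isChain_append, List.getLast?_cons, List.isChain_cons] at h ⊢ <;> grind

open Classical in
noncomputable def fN (k : Type) [Field k] (Q : Quiv) (R : Set (Q.A × Q.A)) (N : ℕ) :
    Chn k Q R 0 →ₗ[k] k :=
  Finsupp.linearCombination k (fun x => if x.1.1.2 ∈ CW Q R N then (1 : k) else 0)

open Classical in
theorem fN_bw (k : Type) [Field k] (Q : Quiv) (R : Set (Q.A × Q.A)) (N : ℕ)
    (y : PathDat Q × PathDat Q) :
    fN k Q R N (bw k Q R 0 y) = if BGmem Q R 0 y ∧ y.1.2 ∈ CW Q R N then 1 else 0 := by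
  by_cases h : BGmem Q R 0 y <;> simp [fN, bw, h]

theorem fN_bd (k : Type) [Field k] (Q : Quiv) (R : Set (Q.A × Q.A)) (N : ℕ) (z : Chn k Q R 1) :
    fN k Q R N (bd k Q R 0 z) = 0 := by
  classical
  induction z using Finsupp.induction_linear with
  | zero => simp
  | add f g hf hg => rw [map_add, map_add, hf, hg, add_zero]
  | single x c =>
    have : Finsupp.single x c = c • Finsupp.single x (1 : k) := by simp
    rw [this, map_smul, map_smul, ← bw_val]
    obtain ⟨⟨⟨u, α⟩, ⟨v, γ⟩⟩, hm⟩ := x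
    obtain ⟨a, rfl⟩ : ∃ a, γ = [a] := List.length_eq_one_iff.1 hm.2.2.1
    rw [bd_bw _ _ _ _ _ hm, map_add, map_smul, fN_bw, fN_bw]
    have h1 : d1raw Q ((u, α), (v, [a])) = ((Q.src a, a :: α), (v, [])) := rfl
    have h2 : d2raw Q ((u, α), (v, [a])) = ((u, α ++ [a]), (Q.tgt a, [])) := rfl
    rw [h1, h2]
    simp only [CW_rotate]
    by_cases hw : a :: α ∈ CW Q R N
    · have hv : Q.src a = v := hm.2.1.1.2 a (by simp)
      have m1 : BGmem Q R 0 ((Q.src a, a :: α), (v, [])) := by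
        have := CW_mem0 Q R N a α hw
        rwa [hv] at this ⊢
      have m2 : BGmem Q R 0 ((u, α ++ [a]), (Q.tgt a, [])) := by
        refine CW_mem0' Q R N a α hw u ?_
        have h3 := hm.1.1.2
        have h4 := hm.2.2.2.2
        have h5 := hm.2.2.2.1
        cases α <;> simp_all [ptgt, psrc]
      simp [m1, m2, hw]
    · simp [hw]

theorem finite_of_hom0 (k : Type) [Field k] (Q : Quiv) (R : Set (Q.A × Q.A))
    (h : HomFinDim k Q R 0) : {p : PathDat Q | InB Q R p}.Finite := by
  classical
  by_contra hinf
  obtain ⟨G, -, hG⟩ := h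
  obtain ⟨N, hN, hN1, w, hw⟩ := exists_CW Q R hinf
    ((G.biUnion Finsupp.support).sup (fun x => x.1.1.2.length) + 1)
  have hker : BSp k Q R 0 ⊔ Submodule.span k ↑G ≤ LinearMap.ker (fN k Q R N) := by
    refine sup_le ?_ ?_
    · rintro _ ⟨z, rfl⟩
      exact fN_bd k Q R N z
    · rw [Submodule.span_le]
      intro z hz
      change fN k Q R N z = 0
      rw [fN, Finsupp.linearCombination_apply, Finsupp.sum]
      refine Finset.sum_eq_zero fun x hx => ?_
      have hle := Finset.le_sup (f := fun x : BGt Q R 0 => x.1.1.2.length)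
        (Finset.mem_biUnion.2 ⟨z, hz, hx⟩)
      rw [if_neg, smul_zero]
      intro hx'
      have := hx'.1
      omega
  cases w with
  | nil => have := hw.1; simp at this; omega
  | cons a l =>
    have h1 : bw k Q R 0 ((Q.src a, a :: l), (Q.src a, [])) ∈ LinearMap.ker (fN k Q R N) :=
      hker (hG (show _ ∈ ZSp k Q R 0 from Submodule.mem_top))
    rw [LinearMap.mem_ker, fN_bw, if_pos ⟨CW_mem0 Q R N a l hw, hw⟩] at h1
    exact one_ne_zero h1

noncomputable def tot0 (k : Type) [Field k] (Q : Quiv) (R : Set (Q.A × Q.A)) :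
    List Q.A → Chn k Q R 0
  | [] => 0
  | a :: l => bw k Q R 0 ((Q.src a, a :: l), (Q.src a, []))

noncomputable def tot1 (k : Type) [Field k] (Q : Quiv) (R : Set (Q.A × Q.A)) :
    List Q.A → Chn k Q R 1
  | [] => 0
  | a :: l => bw k Q R 1 ((Q.tgt a, l), (Q.src a, [a]))

theorem bd_tot1 (k : Type) [Field k] (Q : Quiv) (R : Set (Q.A × Q.A)) (N : ℕ) (w : List Q.A)
    (hw : w ∈ CW Q R N) :
    bd k Q R 0 (tot1 k Q R w) = tot0 k Q R w - tot0 k Q R (w.rotate 1) := by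
  cases w with
  | nil => simp [tot1, tot0]
  | cons a l =>
    have h2 : tot0 k Q R ((a :: l).rotate 1) =
        bw k Q R 0 ((Q.tgt a, l ++ [a]), (Q.tgt a, [])) := by
      rw [CW_cons] at hw
      cases l with
      | nil => simp_all [tot0]
      | cons b l => simp_all [tot0]
    rw [h2, tot1, tot0, bd_bw _ _ _ _ _ (CW_mem1 Q R N a l hw)]
    have h3 : d1raw Q ((Q.tgt a, l), (Q.src a, [a])) = ((Q.src a, a :: l), (Q.src a, [])) := rfl
    have h4 : d2raw Q ((Q.tgt a, l), (Q.src a, [a])) = ((Q.tgt a, l ++ [a]), (Q.tgt a, [])) := rfl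
    rw [h3, h4]
    simp [sub_eq_add_neg]

theorem sum_tot1 (k : Type) [Field k] (Q : Quiv) (R : Set (Q.A × Q.A)) (N : ℕ) :
    bd k Q R 0 (∑ w ∈ (CW_finite Q R N).toFinset, tot1 k Q R w) = 0 := by
  classical
  rw [map_sum, Finset.sum_congr rfl (fun w hw => bd_tot1 k Q R N w (by simpa using hw)),
    Finset.sum_sub_distrib, sub_eq_zero]
  set T := (CW_finite Q R N).toFinset
  have himg : T.image (fun w => w.rotate 1) = T := by
    apply Finset.eq_of_subset_of_card_le
    · intro w hw
      obtain ⟨w', hw', rfl⟩ := Finset.mem_image.1 hw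
      have h1 : w' ∈ CW Q R N := by simpa [T] using hw'
      have h2 : w'.rotate 1 ∈ CW Q R N := by
        cases w' with
        | nil => simpa using h1
        | cons a l =>
          simp only [List.rotate_cons_succ, List.rotate_zero]
          exact (CW_rotate Q R N a l).2 h1
      simpa [T] using h2
    · rw [Finset.card_image_of_injective _ (List.rotate_injective 1)]
  conv_lhs => rw [← himg]
  rw [Finset.sum_image (fun x _ y _ h => List.rotate_injective 1 h)]

theorem coord_bd (k : Type) [Field k] (Q : Quiv) (R : Set (Q.A × Q.A)) (N : ℕ) (a : Q.A)
    (l : List Q.A) (hl : l ≠ []) (hw : a :: l ∈ CW Q R N) (z : Chn k Q R 2) :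
    bd k Q R 1 z ⟨((Q.tgt a, l), (Q.src a, [a])), CW_mem1 Q R N a l hw⟩ = 0 := by
  classical
  have hw' := ((CW_cons Q R N a l).1 hw).2.2
  induction z using Finsupp.induction_linear with
  | zero => simp
  | add f g hf hg => rw [map_add, Finsupp.add_apply, hf, hg, add_zero]
  | single x c =>
    have : Finsupp.single x c = c • Finsupp.single x (1 : k) := by simp
    rw [this, map_smul, Finsupp.smul_apply, ← bw_val]
    obtain ⟨⟨⟨u, α⟩, ⟨v, γ⟩⟩, hm⟩ := x
    obtain ⟨b, c, rfl⟩ : ∃ b c, γ = [b, c] := List.length_eq_two.1 hm.2.2.1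
    have hbc : (b, c) ∈ R := by
      have := hm.2.1.2
      have h' : List.IsChain (fun a b => (a, b) ∈ R) [b, c] := this
      simpa using h'
    rw [bd_bw _ _ _ _ _ hm]
    have h1 : d1raw Q ((u, α), (v, [b, c])) = ((Q.src c, c :: α), (v, [b])) := rfl
    have h2 : d2raw Q ((u, α), (v, [b, c])) = ((u, α ++ [b]), (Q.tgt b, [c])) := rfl
    rw [h1, h2]
    have key : ∀ y : PathDat Q × PathDat Q, y ≠ ((Q.tgt a, l), (Q.src a, [a])) →
        bw k Q R 1 y ⟨((Q.tgt a, l), (Q.src a, [a])), CW_mem1 Q R N a l hw⟩ = 0 := by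
      intro y hy
      by_cases hy' : BGmem Q R 1 y
      · simp only [bw, hy', dite_true]
        rw [Finsupp.single_apply, if_neg]
        intro h
        exact hy (congrArg Subtype.val h)
      · simp [bw, hy']
    rw [Finsupp.add_apply, Finsupp.smul_apply, key, key]
    · simp
    · intro h
      simp only [Prod.mk.injEq, List.cons.injEq, and_true] at h
      obtain ⟨⟨-, rfl⟩, -, rfl⟩ := h
      simp [List.isChain_append, List.isChain_cons] at hw'
      grind
    · intro h
      simp only [Prod.mk.injEq, List.cons.injEq, and_true] at h
      obtain ⟨⟨-, rfl⟩, -, rfl⟩ := h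
      simp [List.isChain_cons] at hw'
      grind

theorem finite_of_hom1 (k : Type) [Field k] (Q : Quiv) (R : Set (Q.A × Q.A))
    (h : HomFinDim k Q R 1) : {p : PathDat Q | InB Q R p}.Finite := by
  classical
  by_contra hinf
  obtain ⟨G, -, hG⟩ := h
  obtain ⟨N, hN, hN1, w, hw⟩ := exists_CW Q R hinf
    ((G.biUnion Finsupp.support).sup (fun x => x.1.1.2.length) + 2)
  cases w with
  | nil => have := hw.1; simp at this; omega
  | cons a l =>
    have hlen : l.length + 1 = N := hw.1
    set x : BGt Q R 1 := ⟨((Q.tgt a, l), (Q.src a, [a])), CW_mem1 Q R N a l hw⟩ with hx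
    have hker : BSp k Q R 1 ⊔ Submodule.span k ↑G ≤
        LinearMap.ker (Finsupp.lapply x : Chn k Q R 1 →ₗ[k] k) := by
      refine sup_le ?_ ?_
      · rintro _ ⟨z, rfl⟩
        exact coord_bd k Q R N a l (by rintro rfl; simp at hlen; omega) hw z
      · rw [Submodule.span_le]
        intro z hz
        change z x = 0
        by_contra hne
        have hle := Finset.le_sup (f := fun x : BGt Q R 1 => x.1.1.2.length)
          (Finset.mem_biUnion.2 ⟨z, hz, Finsupp.mem_support_iff.2 hne⟩)
        have : x.1.1.2.length = l.length := rfl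
        omega
    have h1 := hker (hG (show _ ∈ ZSp k Q R 1 from sum_tot1 k Q R N))
    rw [LinearMap.mem_ker, Finsupp.lapply_apply, Finsupp.finsetSum_apply,
      Finset.sum_eq_single (a :: l)] at h1
    · rw [tot1, show ((Q.tgt a, l), (Q.src a, [a])) = x.1 from rfl, bw_val] at h1
      simp at h1
    · intro w' hw' hne
      have hw2 : w' ∈ CW Q R N := by simpa using hw'
      cases w' with
      | nil => simp [tot1]
      | cons b l' =>
        have : tot1 k Q R (b :: l') = Finsupp.single
          (⟨((Q.tgt b, l'), (Q.src b, [b])), CW_mem1 Q R N b l' hw2⟩ : BGt Q R 1) 1 := by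
          rw [← bw_val]; rfl
        rw [this, Finsupp.single_apply, if_neg]
        intro heq
        have := congrArg Subtype.val heq
        simp only [hx, Prod.mk.injEq, List.cons.injEq, and_true] at this
        exact hne (by rw [this.1.2, this.2.2])
    · intro hn
      exact absurd hw (by simpa using hn)

end helpers


/-- For a quadratic monomial presentation `(Q, R)`:
(1) `B` is finite (i.e. `kQ/⟨R⟩` is finite-dimensional) iff `HH₀` is
finite-dimensional, iff `HH₁` is finite-dimensional; (2) `HH_m` is
finite-dimensional for every `m ≥ 2`. -/
theorem finiteness_of_homology (k : Type) [Field k] (Q : Quiv)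
    (R : Set (Q.A × Q.A)) (hq : IsQuadMon Q R) :
    (({p : PathDat Q | InB Q R p}.Finite ↔ HomFinDim k Q R 0) ∧
     ({p : PathDat Q | InB Q R p}.Finite ↔ HomFinDim k Q R 1)) ∧
    (∀ m : ℕ, 2 ≤ m → HomFinDim k Q R m) := by
  refine ⟨⟨⟨fun h => homFin_of_finite k Q R 0 h, finite_of_hom0 k Q R⟩,
    ⟨fun h => homFin_of_finite k Q R 1 h, finite_of_hom1 k Q R⟩⟩, ?_⟩
  intro m hm
  obtain ⟨n, rfl⟩ : ∃ n, m = n + 2 := ⟨m - 2, by omega⟩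
  exact homFin_ge_two k Q R n

end GentleTT
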